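/- Let ν > -1 and let γ_{ν,1} be the smallest positive zero of 𝒲_ν. Then 2⁴(ν+1)(ν+2)(ν+3)·√((ν+4)(ν+5))/√(5ν+17) < γ_{ν,1}⁴ < 2⁴(ν+1)(ν+2)(ν+3)(ν+4)(ν+5)/(5ν+17). -/

import Mathlib

open Real Set

/-- Bessel function of the first kind `J_ν(x)` (series definition, intended for `x > 0`). -/
noncomputable def besselJ (ν x : ℝ) : ℝ :=
  ∑' n : ℕ, (-1 : ℝ) ^ n * (x / 2) ^ (ν + 2 * (n : ℝ)) /
    ((n.factorial : ℝ) * Real.Gamma (ν + n + 1))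

/-- Modified Bessel function of the first kind `I_ν(x)` (series definition, for `x > 0`). -/
noncomputable def besselI (ν x : ℝ) : ℝ :=
  ∑' n : ℕ, (x / 2) ^ (ν + 2 * (n : ℝ)) /
    ((n.factorial : ℝ) * Real.Gamma (ν + n + 1))

/-- The cross-product `W_ν(x) = J_{ν+1}(x) I_ν(x) + J_ν(x) I_{ν+1}(x)`. -/
noncomputable def crossW (ν x : ℝ) : ℝ :=
  besselJ (ν + 1) x * besselI ν x + besselJ ν x * besselI (ν + 1) x

/-- The normalized cross-product `𝒲_ν`, an even entire function of `x`. -/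
noncomputable def Wcal (ν x : ℝ) : ℝ :=
  ∑' n : ℕ, (-1 : ℝ) ^ n * (Real.Gamma (ν + 1) * Real.Gamma (ν + 2)) * x ^ (4 * n) /
    ((2 : ℝ) ^ (4 * n) * (n.factorial : ℝ) * Real.Gamma (ν + n + 1) * Real.Gamma (ν + 2 * n + 2))

/-- The normalized Dini function `𝒟_ν`. -/
noncomputable def Dcal (ν x : ℝ) : ℝ :=
  ∑' n : ℕ, (-1 : ℝ) ^ n * (2 * (n : ℝ) + 1) * Real.Gamma (ν + 1) * x ^ (2 * n) /
    ((2 : ℝ) ^ (2 * n) * (n.factorial : ℝ) * Real.Gamma (ν + n + 1))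

/-- The normalized modified Dini function `λ_ν`. -/
noncomputable def lamDini (ν x : ℝ) : ℝ :=
  ∑' n : ℕ, (2 * (n : ℝ) + 1) * Real.Gamma (ν + 1) * x ^ (2 * n) /
    ((2 : ℝ) ^ (2 * n) * (n.factorial : ℝ) * Real.Gamma (ν + n + 1))

/-- The normalized Bessel function `𝒥_ν`. -/
noncomputable def Jcal (ν x : ℝ) : ℝ :=
  ∑' n : ℕ, (-1 : ℝ) ^ n * Real.Gamma (ν + 1) * x ^ (2 * n) /
    ((2 : ℝ) ^ (2 * n) * (n.factorial : ℝ) * Real.Gamma (ν + n + 1))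

/-- The normalized modified Bessel function `𝓘_ν`. -/
noncomputable def Ical (ν x : ℝ) : ℝ :=
  ∑' n : ℕ, Real.Gamma (ν + 1) * x ^ (2 * n) /
    ((2 : ℝ) ^ (2 * n) * (n.factorial : ℝ) * Real.Gamma (ν + n + 1))

/-- A function is absolutely monotonic on a set if it is infinitely differentiable there and
all of its (iterated) derivatives are nonnegative there. -/
def AbsolutelyMonotonicOn (f : ℝ → ℝ) (s : Set ℝ) : Prop :=
  ContDiffOn ℝ (⊤ : ℕ∞) f s ∧ ∀ (k : ℕ), ∀ x ∈ s, 0 ≤ iteratedDerivWithin k f s x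

open Polynomial in
/-- real polynomials of the form `∏ (1 - y X)` with all `y > 0` -/
def PosRooted (P : Polynomial ℝ) : Prop :=
  ∃ s : Multiset ℝ, (∀ y ∈ s, 0 < y) ∧ P = (s.map (fun y => 1 - C y * X)).prod

open Polynomial in
lemma posRooted_of_roots (Q : Polynomial ℝ) (h0 : Q.coeff 0 = 1)
    (hr : ∀ z : ℂ, (Q.map Complex.ofRealHom).eval z = 0 → z.im = 0 ∧ 0 < z.re) :
    PosRooted Q := by
  induction hn : Q.natDegree generalizing Q with
  | zero =>
    refine ⟨0, by simp, ?_⟩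
    rw [Polynomial.eq_C_of_natDegree_eq_zero hn, h0]; simp
  | succ n ih =>
    have hQ : (Q.map Complex.ofRealHom).degree ≠ 0 := by
      rw [Polynomial.degree_map]
      intro h
      have := Polynomial.natDegree_eq_of_degree_eq_some (n := 0) (by simpa using h)
      omega
    obtain ⟨z, hz⟩ := IsAlgClosed.exists_root _ hQ
    obtain ⟨hi, hp⟩ := hr z hz
    have hzr : z = Complex.ofRealHom z.re := by
      apply Complex.ext <;> simp [hi]
    have hroot : Q.IsRoot z.re := by
      have : (Q.map Complex.ofRealHom).eval z = 0 := hz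
      rw [hzr, Polynomial.eval_map_apply] at this
      exact (map_eq_zero _).1 this
    obtain ⟨Q', hQ'⟩ := Polynomial.dvd_iff_isRoot.2 hroot
    set r := z.re with hrval
    have hr0 : r ≠ 0 := hp.ne'
    have hfac : Q = (1 - C r⁻¹ * X) * (C (-r) * Q') := by
      have : (X - C r : Polynomial ℝ) = (1 - C r⁻¹ * X) * C (-r) := by
        have : (C r⁻¹ * C r : Polynomial ℝ) = 1 := by rw [← C_mul, inv_mul_cancel₀ hr0, C_1]
        rw [C_neg]
        linear_combination (-X) * this
      rw [← mul_assoc, ← this]; exact hQ'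
    have hQ0 : Q ≠ 0 := by rintro rfl; simp at hn
    have hQ'0 : Q' ≠ 0 := by rintro rfl; simp at hQ'; exact hQ0 hQ'
    obtain ⟨s, hs, hs'⟩ := ih (C (-r) * Q') (by
        have := h0
        rw [hfac, Polynomial.mul_coeff_zero] at this
        simpa using this) (by
        intro w hw
        apply hr
        rw [hfac, Polynomial.map_mul, Polynomial.eval_mul, hw, mul_zero]) (by
        rw [Polynomial.natDegree_C_mul (by simpa using hr0)]
        have := hn
        rw [hQ', Polynomial.natDegree_mul (X_sub_C_ne_zero r) hQ'0, natDegree_X_sub_C] at this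
        omega)
    refine ⟨r⁻¹ ::ₘ s, ?_, ?_⟩
    · intro y hy
      rcases Multiset.mem_cons.1 hy with rfl | hy
      · exact inv_pos.2 hp
      · exact hs y hy
    · rw [Multiset.map_cons, Multiset.prod_cons, ← hs']; exact hfac

open Polynomial in
lemma logderiv_aux (z : ℂ) (s : Multiset ℝ) (hs : ∀ y ∈ s, 0 < y)
    (hz : (((s.map (fun y => 1 - C y * X)).prod).map Complex.ofRealHom).eval z ≠ 0) :
    ∃ (t : ℂ) (k : ℝ),
      z * ((derivative ((s.map (fun y => 1 - C y * X)).prod)).map Complex.ofRealHom).eval z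
        = - (((s.map (fun y => 1 - C y * X)).prod).map Complex.ofRealHom).eval z * t
      ∧ 0 ≤ k ∧ t.im = z.im * k ∧ (k = 0 → t = 0) ∧ (z.im = 0 → z.re ≤ 0 → t.re ≤ 0) := by
  induction s using Multiset.induction with
  | empty => exact ⟨0, 0, by simp⟩
  | cons y s ih =>
    simp only [Multiset.map_cons, Multiset.prod_cons] at hz ⊢
    set P := (s.map (fun y => 1 - C y * X)).prod with hP
    have hy : 0 < y := hs y (by simp)
    rw [Polynomial.map_mul, eval_mul] at hz
    obtain ⟨t, k, h1, h2, h3, h4, h5⟩ := ih (fun w hw => hs w (by simp [hw])) (right_ne_zero_of_mul hz)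
    have hl := left_ne_zero_of_mul hz
    have hl' : (1 - (y:ℂ) * z) ≠ 0 := by simpa using hl
    have hns : 0 < Complex.normSq (1 - (y:ℂ) * z) := Complex.normSq_pos.2 hl'
    refine ⟨(y:ℂ) * z / (1 - y * z) + t, y / Complex.normSq (1 - (y:ℂ) * z) + k, ?_, ?_, ?_, ?_, ?_⟩
    · simp only [derivative_mul, Polynomial.map_mul, eval_mul, Polynomial.map_add, eval_add] at *
      have hq : (y:ℂ) * z / (1 - y * z) * (1 - y * z) = y * z := div_mul_cancel₀ _ hl'
      simp only [derivative_sub, derivative_one, derivative_C, derivative_X, zero_mul, zero_add, zero_sub,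
        mul_one, Polynomial.map_sub, Polynomial.map_one, Polynomial.map_neg, Polynomial.map_mul,
        Polynomial.map_C, Polynomial.map_X, eval_sub, eval_one, eval_mul, eval_C, eval_X, eval_neg,
        Complex.ofRealHom_eq_coe, derivative_mul] at h1 ⊢
      linear_combination (1 - (y:ℂ) * z) * h1 + (P.map Complex.ofRealHom).eval z * hq
    · positivity
    · rw [Complex.add_im, h3, Complex.div_im]
      simp
      field_simp
      ring
    · intro hk
      have : 0 < y / Complex.normSq (1 - (y:ℂ) * z) := by positivity
      linarith
    · intro hi hre
      have := h5 hi hre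
      have hq : ((y:ℂ) * z / (1 - y * z)).re ≤ 0 := by
        rw [Complex.div_re]
        simp [hi]
        have : 0 ≤ 1 - y * z.re := by nlinarith
        apply div_nonpos_of_nonpos_of_nonneg _ hns.le
        nlinarith [mul_nonneg hy.le this]
      rw [Complex.add_re]; linarith

open Polynomial in
lemma PosRooted.coeff_zero {P : Polynomial ℝ} (h : PosRooted P) : P.coeff 0 = 1 := by
  obtain ⟨s, hs, rfl⟩ := h
  rw [Polynomial.coeff_zero_multiset_prod]
  simp

open Polynomial in
lemma PosRooted.step {P : Polynomial ℝ} (h : PosRooted P) (a : ℝ) (ha : 0 < a) :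
    PosRooted (P + C a⁻¹ * (X * derivative P)) := by
  apply posRooted_of_roots
  · simp [h.coeff_zero]
  intro z hz
  obtain ⟨s, hs, hP⟩ := h
  by_cases hPz : (P.map Complex.ofRealHom).eval z = 0
  · rw [hP, Polynomial.map_multiset_prod, Polynomial.eval_multiset_prod, Multiset.prod_eq_zero_iff] at hPz
    simp only [Multiset.mem_map, exists_exists_and_eq_and] at hPz
    obtain ⟨y, hy, hy0⟩ := hPz
    have hyp := hs y hy
    have hzz : z = ((y⁻¹ : ℝ) : ℂ) := by
      simp at hy0
      have : (y:ℂ) ≠ 0 := by exact_mod_cast hyp.ne'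
      push_cast
      field_simp
      linear_combination -hy0
    rw [hzz]
    exact ⟨Complex.ofReal_im _, by rw [Complex.ofReal_re]; positivity⟩
  · obtain ⟨t, k, h1, h2, h3, h4, h5⟩ := logderiv_aux z s hs (hP ▸ hPz)
    rw [← hP] at h1
    have hac : (a:ℂ) ≠ 0 := by exact_mod_cast ha.ne'
    have hta : t = a := by
      simp only [Polynomial.map_add, Polynomial.map_mul, eval_add, eval_mul, Polynomial.map_X, eval_X,
        Polynomial.map_C, eval_C, h1] at hz
      simp at hz
      field_simp at hz
      apply mul_left_cancel₀ hPz
      linear_combination -hz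
    have him : z.im = 0 := by
      rw [hta, Complex.ofReal_im] at h3
      rcases mul_eq_zero.1 h3.symm with h | h
      · exact h
      · exact absurd (hta.symm.trans (h4 h)) hac
    refine ⟨him, ?_⟩
    by_contra hcon
    have := h5 him (not_lt.1 hcon)
    rw [hta, Complex.ofReal_re] at this
    linarith

open Polynomial in
lemma PosRooted.pochStep {P : Polynomial ℝ} (h : PosRooted P) (a : ℝ) (ha : 0 < a) (M : ℕ) :
    ∃ Q, PosRooted Q ∧ ∀ n, Q.coeff n = P.coeff n * ∏ i ∈ Finset.range n, ((a + M + i) / (a + i)) := by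
  induction M with
  | zero =>
    refine ⟨P, h, fun n => ?_⟩
    rw [Finset.prod_eq_one, mul_one]
    intro i _
    have : a + i ≠ 0 := by positivity
    simp [this]
  | succ M ih =>
    obtain ⟨Q, hQ, hc⟩ := ih
    refine ⟨_, hQ.step (a + M) (by positivity), fun n => ?_⟩
    have h1 : (Q + C (a + M)⁻¹ * (X * derivative Q)).coeff n = Q.coeff n * ((a + M + n) / (a + M)) := by
      have : a + M ≠ 0 := by positivity
      cases n with
      | zero => simp [this]
      | succ n =>
        rw [coeff_add, coeff_C_mul, coeff_X_mul, coeff_derivative]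
        push_cast; field_simp
    rw [h1, hc, mul_assoc]
    congr 1
    induction n with
    | zero => have : a + M ≠ 0 := by positivity
              simp [this]
    | succ n ihn =>
      have ihn := ihn (by
        have : a + M ≠ 0 := by positivity
        cases n with
        | zero => simp [this]
        | succ n =>
          rw [coeff_add, coeff_C_mul, coeff_X_mul, coeff_derivative]
          push_cast; field_simp)
      rw [Finset.prod_range_succ, Finset.prod_range_succ, ← ihn]
      have : a + M ≠ 0 := by positivity
      have : a + n ≠ 0 := by positivity
      have : a + M + n ≠ 0 := by positivity
      push_cast
      field_simp
      ring

open Polynomial in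
lemma posRooted_start (c : ℝ) (hc : 0 < c) (N : ℕ) :
    ∃ P, PosRooted P ∧ ∀ n, P.coeff n = (-1) ^ n * (N.choose n * c ^ n) := by
  refine ⟨(1 - C c * X) ^ N, ⟨Multiset.replicate N c, ?_, by simp⟩, fun n => ?_⟩
  · intro y hy; rw [Multiset.eq_of_mem_replicate hy]; exact hc
  · have : (1 - C c * X : Polynomial ℝ) ^ N = ((1 + X) ^ N).comp (C (-c) * X) := by
      simp; ring
    rw [this, Polynomial.comp_C_mul_X_coeff, Polynomial.coeff_one_add_X_pow, neg_pow]
    ring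

open Polynomial in
lemma power_sums (s : Multiset ℝ) :
    let P : Polynomial ℝ := (s.map (fun y => 1 - C y * X)).prod
    P.coeff 0 = 1 ∧ P.coeff 1 = -s.sum ∧
    (s.map (fun y => y ^ 2)).sum = P.coeff 1 ^ 2 - 2 * P.coeff 2 ∧
    (s.map (fun y => y ^ 3)).sum = - P.coeff 1 ^ 3 + 3 * P.coeff 1 * P.coeff 2 - 3 * P.coeff 3 := by
  induction s using Multiset.induction with
  | empty => simp [Polynomial.coeff_one]
  | cons y s ih =>
    simp only [Multiset.map_cons, Multiset.prod_cons, Multiset.sum_cons] at ih ⊢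
    set P := (s.map (fun y => 1 - C y * X)).prod with hP
    obtain ⟨h0, h1, h2, h3⟩ := ih
    have e : (1 - C y * X) * P = P - C y * (X * P) := by ring
    have c0 : ((1 - C y * X) * P).coeff 0 = P.coeff 0 := by rw [e]; simp
    have c1 : ∀ n, ((1 - C y * X) * P).coeff (n+1) = P.coeff (n+1) - y * P.coeff n := by
      intro n; rw [e, coeff_sub, coeff_C_mul, coeff_X_mul]
    have d1 := c1 0
    have d2 := c1 1
    have d3 := c1 2
    norm_num at d1 d2 d3
    rw [c0, d1, d2, d3, h0, h2, h3]
    refine ⟨rfl, by rw [h1]; ring, by ring, by ring⟩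

open Polynomial in
lemma exp_le_prod_aux (s : Multiset ℝ) (x r : ℝ) (hr : r < 1)
    (h : ∀ y ∈ s, 0 ≤ y * x ∧ y * x ≤ r) :
    Real.exp (-s.sum * x / (1 - r)) ≤ (s.map (fun y => 1 - C y * X)).prod.eval x := by
  induction s using Multiset.induction with
  | empty => simp
  | cons y s ih =>
    have ih := ih (fun w hw => h w (by simp [hw]))
    obtain ⟨h1, h2⟩ := h y (by simp)
    simp only [Multiset.map_cons, Multiset.prod_cons, Multiset.sum_cons, eval_mul]
    have e : -(y + s.sum) * x / (1 - r) = -(y * x / (1 - r)) + -s.sum * x / (1 - r) := by ring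
    rw [e, Real.exp_add]
    have h3 : 0 < 1 - y * x := by linarith
    have h4 : 0 < 1 - r := by linarith
    have key : Real.exp (-(y * x / (1 - r))) ≤ 1 - y * x := by
      rw [Real.exp_neg]
      apply inv_le_of_inv_le₀ h3
      have a1 := Real.add_one_le_exp (y * x / (1 - r))
      have a2 : y * x / (1 - y * x) ≤ y * x / (1 - r) := by
        apply div_le_div_of_nonneg_left h1 h4; linarith
      have a3 : (1 - y * x)⁻¹ = y * x / (1 - y * x) + 1 := by field_simp; ring
      linarith
    have : eval x (1 - C y * X) = 1 - y * x := by simp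
    rw [this]
    exact mul_le_mul key ih (Real.exp_pos _).le h3.le

open Polynomial in
lemma PosRooted.lower {P : Polynomial ℝ} (h : PosRooted P) (x r : ℝ) (hx : 0 ≤ x) (hr0 : 0 ≤ r)
    (hr : r < 1)
    (h3 : (- P.coeff 1 ^ 3 + 3 * P.coeff 1 * P.coeff 2 - 3 * P.coeff 3) * x ^ 3 ≤ r ^ 3) :
    Real.exp (P.coeff 1 * x / (1 - r)) ≤ P.eval x := by
  obtain ⟨s, hs, rfl⟩ := h
  obtain ⟨-, c1, -, c3⟩ := power_sums s
  rw [← c3] at h3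
  rw [c1]
  apply exp_le_prod_aux s x r hr
  intro y hy
  have hy0 := hs y hy
  refine ⟨by positivity, ?_⟩
  have hle : y ^ 3 ≤ (s.map (fun y => y ^ 3)).sum := by
    apply Multiset.single_le_sum _ _ (Multiset.mem_map_of_mem _ hy)
    intro w hw
    obtain ⟨v, hv, rfl⟩ := Multiset.mem_map.1 hw
    have := hs v hv
    positivity
  have : (y * x) ^ 3 ≤ r ^ 3 := by
    rw [mul_pow]
    exact (mul_le_mul_of_nonneg_right hle (by positivity)).trans h3
  exact le_of_pow_le_pow_left₀ (by norm_num) hr0 this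

open Polynomial in
lemma PosRooted.upper {P : Polynomial ℝ} (h : PosRooted P)
    (h3 : 0 < (- P.coeff 1 ^ 3 + 3 * P.coeff 1 * P.coeff 2 - 3 * P.coeff 3)) :
    ∃ w, 0 < w ∧ w * (- P.coeff 1 ^ 3 + 3 * P.coeff 1 * P.coeff 2 - 3 * P.coeff 3) ≤
      P.coeff 1 ^ 2 - 2 * P.coeff 2 ∧ P.eval w = 0 := by
  obtain ⟨s, hs, rfl⟩ := h
  obtain ⟨-, c1, c2, c3⟩ := power_sums s
  rw [← c3] at h3 ⊢
  rw [← c2]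
  have hne : s ≠ 0 := by rintro rfl; simp at h3
  have : ∃ y ∈ s, (s.map (fun y => y ^ 3)).sum ≤ y * (s.map (fun y => y ^ 2)).sum := by
    by_contra! hcon
    have hlt := Multiset.sum_lt_sum_of_nonempty (s := s)
      (f := fun y => y ^ 3 * (s.map (fun y => y ^ 2)).sum)
      (g := fun y => y ^ 2 * (s.map (fun y => y ^ 3)).sum) hne (fun y hy => by
        have := hs y hy
        have h2 := mul_lt_mul_of_pos_left (hcon y hy) (show 0 < y ^ 2 by positivity)
        calc _ = y ^ 2 * (y * (s.map (fun y => y ^ 2)).sum) := by ring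
          _ < _ := h2)
    rw [Multiset.sum_map_mul_right, Multiset.sum_map_mul_right, mul_comm] at hlt
    exact lt_irrefl _ hlt
  obtain ⟨y, hy, hle⟩ := this
  have hy0 := hs y hy
  refine ⟨y⁻¹, by positivity, ?_, ?_⟩
  · rw [inv_mul_le_iff₀ hy0]; exact hle
  · rw [Polynomial.eval_multiset_prod]
    apply Multiset.prod_eq_zero
    simp only [Multiset.map_map, Multiset.mem_map]
    exact ⟨y, hy, by simp [hy0.ne']⟩

open Filter Topology in
lemma limit_eval (Q : ℕ → Polynomial ℝ) (A : ℕ → ℝ) (K : ℝ)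
    (hb : ∀ N n, |(Q N).coeff n| ≤ K ^ n / n.factorial)
    (hl : ∀ n, Tendsto (fun N => (Q N).coeff n) atTop (𝓝 ((-1) ^ n * A n)))
    (x : ℕ → ℝ) (x0 : ℝ) (hx : Tendsto x atTop (𝓝 x0)) (φ : ℕ → ℕ) (hφ : Tendsto φ atTop atTop) :
    Tendsto (fun N => (Q (φ N)).eval (x N)) atTop (𝓝 (∑' n, (-1) ^ n * A n * x0 ^ n)) := by
  have he : ∀ N, (Q (φ N)).eval (x N) = ∑' n, (Q (φ N)).coeff n * x N ^ n := by
    intro N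
    rw [Polynomial.eval_eq_sum_range]
    symm
    apply tsum_eq_sum
    intro n hn
    rw [Polynomial.coeff_eq_zero_of_natDegree_lt, zero_mul]
    simpa [Nat.lt_succ_iff] using hn
  simp_rw [he]
  have hK : ∀ n : ℕ, 0 ≤ K ^ n / (n.factorial : ℝ) := fun n => (abs_nonneg _).trans (hb 0 n)
  have hsum : Summable (fun n : ℕ => (K * (|x0| + 1)) ^ n / (n.factorial : ℝ)) :=
    Real.summable_pow_div_factorial _
  have hx1 : ∀ᶠ N in atTop, |x N| < |x0| + 1 := hx.abs.eventually_lt_const (lt_add_one _)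
  have hdom : ∀ᶠ N in atTop, ∀ n : ℕ, ‖(Q (φ N)).coeff n * x N ^ n‖ ≤
      (K * (|x0| + 1)) ^ n / (n.factorial : ℝ) := by
    filter_upwards [hx1] with N hN n
    rw [Real.norm_eq_abs, abs_mul, abs_pow, mul_pow, mul_div_right_comm]
    exact mul_le_mul (hb _ n) (pow_le_pow_left₀ (abs_nonneg _) hN.le n)
      (pow_nonneg (abs_nonneg _) n) (hK n)
  have hpt : ∀ n : ℕ, Tendsto (fun N => (Q (φ N)).coeff n * x N ^ n) atTop
      (𝓝 ((-1) ^ n * A n * x0 ^ n)) := fun n => ((hl n).comp hφ).mul (hx.pow n)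
  exact tendsto_tsum_of_dominated_convergence hsum hpt hdom

open Filter Topology in
lemma limit_bounds (Q : ℕ → Polynomial ℝ) (A : ℕ → ℝ) (K : ℝ)
    (hP : ∀ N, PosRooted (Q N))
    (hb : ∀ N n, |(Q N).coeff n| ≤ K ^ n / n.factorial)
    (hl : ∀ n, Tendsto (fun N => (Q N).coeff n) atTop (𝓝 ((-1) ^ n * A n)))
    (hA0 : A 0 = 1)
    (hs3 : 0 < A 1 ^ 3 - 3 * A 1 * A 2 + 3 * A 3) :
    (∀ x, 0 ≤ x → (A 1 ^ 3 - 3 * A 1 * A 2 + 3 * A 3) * x ^ 3 < 1 →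
      0 < ∑' n, (-1) ^ n * A n * x ^ n) ∧
    ∃ w, 0 < w ∧ w * (A 1 ^ 3 - 3 * A 1 * A 2 + 3 * A 3) ≤ A 1 ^ 2 - 2 * A 2 ∧
      ∑' n, (-1) ^ n * A n * w ^ n = 0 := by
  set s3 := A 1 ^ 3 - 3 * A 1 * A 2 + 3 * A 3 with hs3val
  set s2 := A 1 ^ 2 - 2 * A 2 with hs2val
  have l1 := hl 1
  have l2 := hl 2
  have l3 := hl 3
  have t2 : Tendsto (fun N => (Q N).coeff 1 ^ 2 - 2 * (Q N).coeff 2) atTop (𝓝 s2) := by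
    have := (l1.pow 2).sub (l2.const_mul 2)
    convert this using 2; rw [hs2val]; ring
  have t3 : Tendsto (fun N => - (Q N).coeff 1 ^ 3 + 3 * (Q N).coeff 1 * (Q N).coeff 2
      - 3 * (Q N).coeff 3) atTop (𝓝 s3) := by
    have := (((l1.pow 3).neg).add ((l1.const_mul 3).mul l2)).sub (l3.const_mul 3)
    convert this using 2; rw [hs3val]; ring
  constructor
  · intro x hx hx1
    obtain ⟨q, hq1, hq2⟩ := exists_between hx1
    have hq0 : 0 < q := lt_of_le_of_lt (by positivity) hq1
    set r := q ^ ((1:ℝ)/3) with hr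
    have hr3 : r ^ 3 = q := by
      rw [hr, ← Real.rpow_natCast, ← Real.rpow_mul hq0.le]; norm_num
    have hr0 : 0 ≤ r := by positivity
    have hr1 : r < 1 := by
      by_contra hcon
      have : 1 ≤ r ^ 3 := one_le_pow₀ (not_lt.1 hcon)
      linarith
    have ev : ∀ᶠ N in atTop, Real.exp ((Q N).coeff 1 * x / (1 - r)) ≤ (Q N).eval x := by
      have := (t3.mul_const (x ^ 3)).eventually_lt_const hq1
      filter_upwards [this] with N hN
      exact (hP N).lower x r hx hr0 hr1 (by rw [hr3]; exact hN.le)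
    have lim1 := limit_eval Q A K hb hl (fun _ => x) x tendsto_const_nhds id tendsto_id
    have lim2 := (Real.continuous_exp.tendsto _).comp ((l1.mul_const x).div_const (1 - r))
    exact lt_of_lt_of_le (Real.exp_pos _) (le_of_tendsto_of_tendsto lim2 lim1 ev)
  · have ev : ∀ᶠ N in atTop, 0 < - (Q N).coeff 1 ^ 3 + 3 * (Q N).coeff 1 * (Q N).coeff 2
      - 3 * (Q N).coeff 3 := t3.eventually_const_lt hs3
    have ex : ∀ N, ∃ w, 0 < - (Q N).coeff 1 ^ 3 + 3 * (Q N).coeff 1 * (Q N).coeff 2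
      - 3 * (Q N).coeff 3 → (0 < w ∧ w * (- (Q N).coeff 1 ^ 3 + 3 * (Q N).coeff 1 * (Q N).coeff 2
      - 3 * (Q N).coeff 3) ≤ (Q N).coeff 1 ^ 2 - 2 * (Q N).coeff 2 ∧ (Q N).eval w = 0) := by
      intro N
      by_cases h : 0 < - (Q N).coeff 1 ^ 3 + 3 * (Q N).coeff 1 * (Q N).coeff 2 - 3 * (Q N).coeff 3
      · obtain ⟨w, hw⟩ := (hP N).upper h
        exact ⟨w, fun _ => hw⟩
      · exact ⟨0, fun h' => absurd h' h⟩
    choose w hw using ex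
    have ev' := ev.mono (fun N hN => hw N hN)
    have evb : ∀ᶠ N in atTop, w N ∈ Set.Icc 0 (s2 / s3 + 1) := by
      have := (t2.div t3 hs3.ne').eventually_lt_const (show s2 / s3 < s2 / s3 + 1 by linarith)
      filter_upwards [this, ev, ev'] with N h1 h2 h3
      refine ⟨h3.1.le, ?_⟩
      have := (le_div_iff₀ h2).2 h3.2.1
      exact this.trans h1.le
    obtain ⟨w0, hw0, φ, hφ, hlim⟩ := isCompact_Icc.tendsto_subseq' evb.frequently
    have hφ' := hφ.tendsto_atTop
    have lim1 := limit_eval Q A K hb hl (w ∘ φ) w0 hlim φ hφ'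
    have hzero : ∑' n, (-1) ^ n * A n * w0 ^ n = 0 := by
      apply tendsto_nhds_unique lim1
      apply tendsto_const_nhds.congr'
      filter_upwards [hφ'.eventually ev'] with N hN
      exact hN.2.2.symm
    refine ⟨w0, ?_, ?_, hzero⟩
    · rcases hw0.1.lt_or_eq with h | h
      · exact h
      · exfalso
        rw [← h, tsum_eq_single 0 (by intro n hn; simp [hn])] at hzero
        simp [hA0] at hzero
    · apply le_of_tendsto_of_tendsto (hlim.mul (t3.comp hφ')) (t2.comp hφ')
      filter_upwards [hφ'.eventually ev'] with N hN
      exact hN.2.1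

lemma pochRatio_eq (a : ℝ) (ha : 0 < a) (N n : ℕ) :
    ((N + 1 : ℝ)⁻¹) ^ n * ∏ i ∈ Finset.range n, ((a + (N + 1 : ℕ) + i) / (a + i)) =
      ∏ i ∈ Finset.range n, ((a + i)⁻¹ + (N + 1 : ℝ)⁻¹) := by
  induction n with
  | zero => simp
  | succ n ih =>
    rw [Finset.prod_range_succ, Finset.prod_range_succ, ← ih, pow_succ]
    have : a + n ≠ 0 := by positivity
    have : (N + 1 : ℝ) ≠ 0 := by positivity
    have e : (a + n)⁻¹ + (N + 1 : ℝ)⁻¹ = (N + 1 : ℝ)⁻¹ * ((a + (N + 1 : ℕ) + n) / (a + n)) := by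
      push_cast; field_simp; ring
    rw [e]; ring

open Filter Topology in
lemma tendsto_inv_succ : Tendsto (fun N : ℕ => (N + 1 : ℝ)⁻¹) atTop (𝓝 0) := by
  simpa [one_div] using tendsto_one_div_add_atTop_nhds_zero_nat (𝕜 := ℝ)

open Filter Topology in
lemma pochRatio_tendsto (a : ℝ) (n : ℕ) :
    Tendsto (fun N : ℕ => ∏ i ∈ Finset.range n, ((a + i)⁻¹ + (N + 1 : ℝ)⁻¹)) atTop
      (𝓝 (∏ i ∈ Finset.range n, (a + i)⁻¹)) := by
  apply tendsto_finsetProd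
  intro i _
  simpa using (tendsto_const_nhds (x := (a + i)⁻¹)).add tendsto_inv_succ

lemma pochRatio_le (a : ℝ) (ha : 0 < a) (N n : ℕ) :
    |∏ i ∈ Finset.range n, ((a + i)⁻¹ + (N + 1 : ℝ)⁻¹)| ≤ (a⁻¹ + 1) ^ n := by
  rw [abs_of_nonneg (Finset.prod_nonneg (fun i _ => by positivity))]
  calc _ ≤ ∏ i ∈ Finset.range n, (a⁻¹ + 1) := by
        apply Finset.prod_le_prod
        · intro i _; positivity
        · intro i _
          apply add_le_add
          · apply inv_anti₀ ha; linarith [Nat.cast_nonneg (α := ℝ) i]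
          · apply inv_le_one_of_one_le₀; linarith [Nat.cast_nonneg (α := ℝ) N]
    _ = _ := by simp

open Filter Topology in
lemma choose_tendsto (n : ℕ) :
    Tendsto (fun N : ℕ => ((N + 1).choose n : ℝ) * ((N + 1 : ℝ)⁻¹) ^ n) atTop
      (𝓝 ((n.factorial : ℝ)⁻¹)) := by
  induction n with
  | zero => simp
  | succ n ih =>
    have h1 : Tendsto (fun N : ℕ => (1 - n * (N + 1 : ℝ)⁻¹) / (n + 1)) atTop
        (𝓝 ((1 - n * 0) / (n + 1))) :=
      ((tendsto_const_nhds).sub (tendsto_inv_succ.const_mul _)).div_const _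
    have h2 := ih.mul h1
    have e : (n.factorial : ℝ)⁻¹ * ((1 - n * 0) / (n + 1)) = ((n + 1).factorial : ℝ)⁻¹ := by
      rw [Nat.factorial_succ]; push_cast; field_simp; ring
    rw [e] at h2
    apply h2.congr'
    filter_upwards [eventually_ge_atTop n] with N hN
    have h3 := Nat.choose_succ_right_eq (N + 1) n
    have h4 : ((N + 1).choose (n + 1) : ℝ) * (n + 1) = (N + 1).choose n * (N + 1 - n) := by
      have := congrArg (Nat.cast (R := ℝ)) h3
      rw [Nat.cast_mul, Nat.cast_mul, Nat.cast_sub (by omega)] at this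
      push_cast at this; exact this
    have h5 : ((N + 1).choose (n + 1) : ℝ) = (N + 1).choose n * (N + 1 - n) / (n + 1) := by
      rw [eq_div_iff (by positivity)]; exact h4
    rw [h5, pow_succ]
    field_simp

lemma choose_le_aux (N n : ℕ) :
    |((N + 1).choose n : ℝ) * ((N + 1 : ℝ)⁻¹) ^ n| ≤ 1 / n.factorial := by
  rw [abs_of_nonneg (by positivity)]
  have := Nat.choose_le_pow_div (α := ℝ) n (N + 1)
  calc _ ≤ (((N + 1 : ℕ) : ℝ) ^ n / n.factorial) * ((N + 1 : ℝ)⁻¹) ^ n := by gcongr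
    _ = _ := by
      have : ((N + 1 : ℕ) : ℝ) ^ n * ((N + 1 : ℝ)⁻¹) ^ n = 1 := by
        rw [← mul_pow]; push_cast; rw [mul_inv_cancel₀ (by positivity), one_pow]
      rw [div_mul_eq_mul_div, this]

lemma wcoef_exists (a b c : ℝ) (ha : 0 < a) (hb : 0 < b) (hc : 0 < c) (N : ℕ) :
    ∃ Q, PosRooted Q ∧ ∀ n, Q.coeff n = (-1) ^ n *
      ((((N + 1).choose n : ℝ) * ((N + 1 : ℝ)⁻¹) ^ n) * (1/4) ^ n *
      (∏ i ∈ Finset.range n, ((a + i)⁻¹ + (N + 1 : ℝ)⁻¹)) *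
      (∏ i ∈ Finset.range n, ((b + i)⁻¹ + (N + 1 : ℝ)⁻¹)) *
      (∏ i ∈ Finset.range n, ((c + i)⁻¹ + (N + 1 : ℝ)⁻¹))) := by
  obtain ⟨P, hP, h0⟩ := posRooted_start ((1/4) * ((N + 1 : ℝ)⁻¹) ^ 4) (by positivity) (N + 1)
  obtain ⟨P1, hP1, h1⟩ := hP.pochStep a ha (N + 1)
  obtain ⟨P2, hP2, h2⟩ := hP1.pochStep b hb (N + 1)
  obtain ⟨P3, hP3, h3⟩ := hP2.pochStep c hc (N + 1)
  refine ⟨P3, hP3, fun n => ?_⟩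
  rw [h3, h2, h1, h0, ← pochRatio_eq a ha, ← pochRatio_eq b hb, ← pochRatio_eq c hc]
  ring

/-- coefficients of the entire function in `z = x^4/16` -/
noncomputable def wcoef (ν : ℝ) (n : ℕ) : ℝ :=
  (n.factorial : ℝ)⁻¹ * (1/4) ^ n * (∏ i ∈ Finset.range n, (ν + 1 + i)⁻¹) *
    (∏ i ∈ Finset.range n, ((ν + 2) / 2 + i)⁻¹) * (∏ i ∈ Finset.range n, ((ν + 3) / 2 + i)⁻¹)

lemma wcoef_succ (ν : ℝ) (n : ℕ) : wcoef ν (n + 1) =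
    wcoef ν n * ((n + 1) * ((ν + n + 1) * ((ν + 2 * n + 2) * (ν + 2 * n + 3))))⁻¹ := by
  have q1 : (ν + 1 + n)⁻¹ = (ν + n + 1)⁻¹ := by congr 1; ring
  have q2 : ((ν + 2) / 2 + n)⁻¹ = 2 * (ν + 2 * n + 2)⁻¹ := by
    rw [show (ν + 2) / 2 + n = (ν + 2 * n + 2) / 2 by ring, inv_div, div_eq_mul_inv]
  have q3 : ((ν + 3) / 2 + n)⁻¹ = 2 * (ν + 2 * n + 3)⁻¹ := by
    rw [show (ν + 3) / 2 + n = (ν + 2 * n + 3) / 2 by ring, inv_div, div_eq_mul_inv]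
  unfold wcoef
  rw [Finset.prod_range_succ, Finset.prod_range_succ, Finset.prod_range_succ, q1, q2, q3,
    Nat.factorial_succ, pow_succ]
  push_cast
  rw [mul_inv, mul_inv, mul_inv, mul_inv]
  ring

lemma wcoef_gamma (ν : ℝ) (hν : -1 < ν) (n : ℕ) :
    wcoef ν n = Real.Gamma (ν + 1) * Real.Gamma (ν + 2) /
      (n.factorial * Real.Gamma (ν + n + 1) * Real.Gamma (ν + 2 * n + 2)) := by
  induction n with
  | zero =>
    have h1 : Real.Gamma (ν + 1) ≠ 0 := (Real.Gamma_pos_of_pos (by linarith)).ne'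
    have h2 : Real.Gamma (ν + 2) ≠ 0 := (Real.Gamma_pos_of_pos (by linarith)).ne'
    simp [wcoef, h1, h2]
  | succ n ih =>
    have hn : (0:ℝ) ≤ n := Nat.cast_nonneg n
    have e1 := wcoef_succ ν n
    have g1 : Real.Gamma (ν + (n + 1 : ℕ) + 1) = (ν + n + 1) * Real.Gamma (ν + n + 1) := by
      rw [← Real.Gamma_add_one (by linarith)]; push_cast; congr 1; ring
    have g2 : Real.Gamma (ν + 2 * (n + 1 : ℕ) + 2) =
        (ν + 2 * n + 3) * ((ν + 2 * n + 2) * Real.Gamma (ν + 2 * n + 2)) := by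
      rw [← Real.Gamma_add_one (by linarith),
        show ν + 2 * n + 2 + 1 = ν + 2 * n + 3 by ring, ← Real.Gamma_add_one (by linarith)]
      push_cast; congr 1; ring
    rw [e1, ih, g1, g2, Nat.factorial_succ]
    push_cast
    rw [← div_eq_mul_inv, div_div]
    congr 1; ring

lemma Wcal_eq (ν : ℝ) (hν : -1 < ν) (x : ℝ) :
    Wcal ν x = ∑' n, (-1) ^ n * wcoef ν n * (x ^ 4 / 16) ^ n := by
  unfold Wcal
  congr 1; ext n
  rw [wcoef_gamma ν hν n, div_pow, ← pow_mul, show (16:ℝ) = 2 ^ 4 by norm_num, ← pow_mul]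
  rw [div_eq_mul_inv, div_eq_mul_inv, div_eq_mul_inv]
  simp only [mul_inv]
  ring

open Filter Topology in
lemma wcoef_bounds (ν : ℝ) (hν : -1 < ν)
    (hs3 : 0 < wcoef ν 1 ^ 3 - 3 * wcoef ν 1 * wcoef ν 2 + 3 * wcoef ν 3) :
    (∀ x, 0 ≤ x → (wcoef ν 1 ^ 3 - 3 * wcoef ν 1 * wcoef ν 2 + 3 * wcoef ν 3) * x ^ 3 < 1 →
      0 < ∑' n, (-1) ^ n * wcoef ν n * x ^ n) ∧
    ∃ w, 0 < w ∧ w * (wcoef ν 1 ^ 3 - 3 * wcoef ν 1 * wcoef ν 2 + 3 * wcoef ν 3) ≤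
      wcoef ν 1 ^ 2 - 2 * wcoef ν 2 ∧ ∑' n, (-1) ^ n * wcoef ν n * w ^ n = 0 := by
  have ha : 0 < ν + 1 := by linarith
  have hb : 0 < (ν + 2) / 2 := by linarith
  have hc : 0 < (ν + 3) / 2 := by linarith
  choose Q hQ hco using wcoef_exists _ _ _ ha hb hc
  refine limit_bounds Q (wcoef ν)
    ((1/4) * ((ν + 1)⁻¹ + 1) * (((ν + 2) / 2)⁻¹ + 1) * (((ν + 3) / 2)⁻¹ + 1)) hQ ?_ ?_ ?_ hs3
  · intro N n
    rw [hco, abs_mul, abs_pow, abs_neg, abs_one, one_pow, one_mul, abs_mul, abs_mul, abs_mul, abs_mul]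
    rw [abs_of_nonneg (show (0:ℝ) ≤ (1/4) ^ n by positivity)]
    calc _ ≤ 1 / n.factorial * (1/4) ^ n * ((ν + 1)⁻¹ + 1) ^ n * (((ν + 2) / 2)⁻¹ + 1) ^ n
            * (((ν + 3) / 2)⁻¹ + 1) ^ n := by
          have := choose_le_aux N n
          have := pochRatio_le _ ha N n
          have := pochRatio_le _ hb N n
          have := pochRatio_le _ hc N n
          gcongr
      _ = _ := by simp only [mul_pow]; ring
  · intro n
    simp_rw [hco]
    exact ((((((choose_tendsto n).mul_const _).mul (pochRatio_tendsto _ n)).mul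
      (pochRatio_tendsto _ n)).mul (pochRatio_tendsto _ n)).const_mul _)
  · simp [wcoef]

/-- Bounds for the fourth power of the smallest positive zero of the cross-product of Bessel
functions. -/
theorem gamma1_fourth_power_bounds (ν : ℝ) (hν : -1 < ν) (γ1 : ℝ)
    (hγ1pos : 0 < γ1) (hγ1zero : Wcal ν γ1 = 0)
    (hγ1min : ∀ x : ℝ, 0 < x → Wcal ν x = 0 → γ1 ≤ x) :
    2 ^ 4 * ((ν + 1) * (ν + 2) * (ν + 3)) * Real.sqrt ((ν + 4) * (ν + 5)) /
        Real.sqrt (5 * ν + 17) < γ1 ^ 4 ∧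
      γ1 ^ 4 < 2 ^ 4 * ((ν + 1) * (ν + 2) * (ν + 3) * (ν + 4) * (ν + 5)) / (5 * ν + 17) := by
  have hWc := Wcal_eq ν hν
  obtain ⟨u, rfl⟩ : ∃ u, ν = u - 1 := ⟨ν + 1, by ring⟩
  have hu : 0 < u := by linarith
  set A := wcoef (u - 1) with hA
  have A1 : A 1 = (u * (u + 1) * (u + 2))⁻¹ := by
    rw [hA, wcoef_succ, show wcoef (u - 1) 0 = 1 by simp [wcoef], one_mul]
    congr 1; push_cast; ring
  have A2 : A 2 = (2 * (u * (u + 1)) * ((u + 1) * (u + 2) * (u + 3) * (u + 4)))⁻¹ := by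
    rw [hA, wcoef_succ, ← hA, A1, ← mul_inv]
    congr 1; push_cast; ring
  have A3 : A 3 = (6 * (u * (u + 1) * (u + 2)) *
      ((u + 1) * (u + 2) * (u + 3) * (u + 4) * (u + 5) * (u + 6)))⁻¹ := by
    rw [hA, wcoef_succ, ← hA, A2, ← mul_inv]
    congr 1; push_cast; ring
  have hs2 : A 1 ^ 2 - 2 * A 2 = (5 * u + 12) / ((u * (u + 1) * (u + 2)) ^ 2 * ((u + 3) * (u + 4))) := by
    rw [A1, A2]; field_simp; ring
  have hs3 : A 1 ^ 3 - 3 * A 1 * A 2 + 3 * A 3 = (42 * u ^ 2 + 252 * u + 360) /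
      ((u * (u + 1) * (u + 2)) ^ 3 * ((u + 3) * (u + 4) * (u + 5) * (u + 6))) := by
    rw [A1, A2, A3]; field_simp; ring
  set s2 := A 1 ^ 2 - 2 * A 2 with s2val
  set s3 := A 1 ^ 3 - 3 * A 1 * A 2 + 3 * A 3 with s3val
  have s2pos : 0 < s2 := by rw [hs2]; positivity
  have s3pos : 0 < s3 := by rw [hs3]; positivity
  have i1 : s3 ^ 2 < s2 ^ 3 := by
    rw [hs2, hs3, div_pow, div_pow, div_lt_div_iff₀ (by positivity) (by positivity), ← sub_pos]
    have : (5 * u + 12) ^ 3 * ((u * (u + 1) * (u + 2)) ^ 3 * ((u + 3) * (u + 4) * (u + 5) * (u + 6))) ^ 2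
        - (42 * u ^ 2 + 252 * u + 360) ^ 2 * ((u * (u + 1) * (u + 2)) ^ 2 * ((u + 3) * (u + 4))) ^ 3
      = (u * (u + 1) * (u + 2)) ^ 6 * (3421440*u^2 + 10300608*u^3 + 13639536*u^4 + 10426932*u^5
        + 5072184*u^6 + 1628537*u^7 + 345204*u^8 + 46598*u^9 + 3636*u^10 + 125*u^11) := by ring
    rw [this]; positivity
  have i2 : s2 ^ 2 < A 1 * s3 := by
    have : A 1 * s3 - s2 ^ 2 = (4320*u + 7488*u^2 + 5070*u^3 + 1675*u^4 + 270*u^5 + 17*u^6) /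
      ((u * (u + 1) * (u + 2)) ^ 4 * ((u + 3) * (u + 4)) ^ 2 * ((u + 3) * (u + 4) * (u + 5) * (u + 6))) := by
      rw [hs2, hs3, A1]; field_simp; ring
    rw [← sub_pos, this]; positivity
  obtain ⟨hlow, w, hw0, hwle, hwz⟩ := wcoef_bounds (u - 1) hν s3pos
  have hz0 : 0 < γ1 ^ 4 / 16 := by positivity
  constructor
  · have key : 1 < s2 * (γ1 ^ 4 / 16) ^ 2 := by
      by_contra hcon
      have hcon := not_lt.1 hcon
      have h1 : (s2 * (γ1 ^ 4 / 16) ^ 2) ^ 3 ≤ 1 := pow_le_one₀ (by positivity) hcon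
      have h2 : (s3 * (γ1 ^ 4 / 16) ^ 3) ^ 2 < 1 := by
        refine lt_of_lt_of_le ?_ h1
        rw [mul_pow, mul_pow, ← pow_mul, ← pow_mul]
        exact mul_lt_mul_of_pos_right i1 (by positivity)
      have h3 : s3 * (γ1 ^ 4 / 16) ^ 3 < 1 := by
        by_contra h
        have := one_le_pow₀ (n := 2) (not_lt.1 h)
        linarith
      have := hlow _ hz0.le h3
      rw [← hWc, hγ1zero] at this
      exact lt_irrefl _ this
    have hq : 0 < 5 * (u - 1) + 17 := by linarith
    rw [div_lt_iff₀ (Real.sqrt_pos.2 hq)]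
    apply lt_of_pow_lt_pow_left₀ 2 (by positivity)
    rw [mul_pow, mul_pow _ (√(5 * (u - 1) + 17)), Real.sq_sqrt hq.le,
      Real.sq_sqrt (mul_nonneg (by linarith) (by linarith))]
    rw [hs2, div_mul_eq_mul_div, lt_div_iff₀ (by positivity)] at key
    nlinarith [key]
  · have hws : w < A 1 / s2 := by
      rw [lt_div_iff₀ s2pos]
      by_contra h
      have h := not_lt.1 h
      have h1 : A 1 * s3 ≤ w * s2 * s3 := mul_le_mul_of_nonneg_right h s3pos.le
      have h2 : w * s3 * s2 ≤ s2 * s2 := mul_le_mul_of_nonneg_right hwle s2pos.le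
      nlinarith
    set x := (16 * w) ^ ((1:ℝ)/4) with hx
    have hx4 : x ^ 4 = 16 * w := by
      rw [hx, ← Real.rpow_natCast, ← Real.rpow_mul (by positivity)]; norm_num
    have hx0 : 0 < x := by positivity
    have hle := hγ1min x hx0 (by
      rw [hWc, hx4, mul_div_cancel_left₀ _ (by norm_num)]; exact hwz)
    have h4 : γ1 ^ 4 ≤ 16 * w := by
      rw [← hx4]; exact pow_le_pow_left₀ hγ1pos.le hle 4
    have e : 2 ^ 4 * ((u - 1 + 1) * (u - 1 + 2) * (u - 1 + 3) * (u - 1 + 4) * (u - 1 + 5)) /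
        (5 * (u - 1) + 17) = 16 * (A 1 / s2) := by
      have : 5 * (u - 1) + 17 = 5 * u + 12 := by ring
      rw [A1, hs2, this]; field_simp; ring
    rw [e]; linarith
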